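/- Let Γ₃ = ℤ(1+i) + ℤ(1−i) ⊂ ℂ and Γ₂ = ℤ + ℤi ⊂ ℂ, let T = (ℂ/Γ₃) × (ℂ/Γ₂) × (ℂ/Γ₂), let F : T → T be induced by z ↦ (iz₁, iz₂ − iz₁, −z₃), let M be the mapping torus of F, let κ : M → M be κ[t,x] = [1−t, η(x)] with η : T → T induced by z ↦ (−z̄₁, z̄₂ + z̄₁, −z̄₃), and let X = M/κ be the quotient topological space. Then X is simply connected (path-connected with trivial fundamental group). -/

import Mathlib

/-- The Gaussian lattice `Γ₂ = ℤ + ℤi ⊂ ℂ`. -/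
noncomputable def Γ₂ : AddSubgroup ℂ := AddSubgroup.closure {1, Complex.I}

/-- The index-2 sublattice `Γ₃ = ℤ(1+i) + ℤ(1−i) ⊂ Γ₂`. -/
noncomputable def Γ₃ : AddSubgroup ℂ :=
  AddSubgroup.closure {1 + Complex.I, 1 - Complex.I}

/-- The torus `T = (ℂ/Γ₃) × (ℂ/Γ₂) × (ℂ/Γ₂)`. -/
abbrev T₃ : Type := (ℂ ⧸ Γ₃) × (ℂ ⧸ Γ₂) × (ℂ ⧸ Γ₂)

/-- The projection `ℂ → ℂ/Γ₃`. -/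
noncomputable def mkA : ℂ → ℂ ⧸ Γ₃ := QuotientAddGroup.mk

/-- The projection `ℂ → ℂ/Γ₂`. -/
noncomputable def mkB : ℂ → ℂ ⧸ Γ₂ := QuotientAddGroup.mk

/-- The mapping-torus relation on `ℝ × T` generated by `(t, x) ∼ (t + 1, F x)`. -/
def mtRel (F : T₃ → T₃) (x y : ℝ × T₃) : Prop := y = (x.1 + 1, F x.2)


namespace X134
set_option linter.unusedSectionVars false
open unitInterval

section Abstract

variable {X : Type*} [TopologicalSpace X]

theorem cast_trans_refl {a c q : X} (α : Path a c) (e : q = c) :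
    ((α.cast rfl e).trans ((Path.refl c).cast e rfl)).Homotopic α := by
  subst e
  exact ⟨Path.Homotopy.transRefl _⟩

theorem square_homotopic (S : C(I × I, X)) {a b c : X} (γ : Path a b) (α : Path a c)
    (β : Path b c) (h1 : ∀ u, S (u, 0) = γ u) (h2 : ∀ v, S (0, v) = α v)
    (h3 : ∀ v, S (1, v) = β v) (h4 : ∀ u, S (u, 1) = c) :
    γ.Homotopic (α.trans β.symm) := by
  have ea : a = S (0, 0) := by rw [h1]; simp
  have eb : b = S (1, 0) := by rw [h1]; simp
  have ec : c = S (0, 1) := by rw [h2]; simp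
  have ec' : S (0, 1) = S (1, 1) := by rw [h4, h4]
  subst ea eb
  have ec2 : c = S (1, 1) := by rw [h3]; simp
  subst ec2
  let bot : Path ((0, 0) : I × I) (1, 0) :=
    ⟨⟨fun u => (u, 0), by fun_prop⟩, rfl, rfl⟩
  let lft : Path ((0, 0) : I × I) (0, 1) :=
    ⟨⟨fun u => (0, u), by fun_prop⟩, rfl, rfl⟩
  let tp : Path ((0, 1) : I × I) (1, 1) :=
    ⟨⟨fun u => (u, 1), by fun_prop⟩, rfl, rfl⟩
  let rgt : Path ((1, 0) : I × I) (1, 1) :=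
    ⟨⟨fun u => (1, u), by fun_prop⟩, rfl, rfl⟩
  have : ContractibleSpace I :=
    (convex_Icc (0:ℝ) 1).contractibleSpace ⟨0, by simp⟩
  have H := (SimplyConnectedSpace.paths_homotopic bot ((lft.trans tp).trans rgt.symm)).map S
  have e1 : bot.map S.continuous = γ := by
    ext u; exact h1 u
  rw [Path.map_trans, Path.map_trans, e1] at H
  refine H.trans ?_
  have e2 : (rgt.symm).map S.continuous = β.symm := by
    ext u; exact h3 (σ u)
  rw [e2]
  refine Path.Homotopic.hcomp ?_ (Path.Homotopic.refl _)
  have e3 : lft.map S.continuous = α.cast rfl ec' := by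
    ext u; exact h2 u
  have e4 : tp.map S.continuous = (Path.refl (S (1,1))).cast ec' rfl := by
    ext u; exact h4 u
  rw [e3, e4]
  exact cast_trans_refl _ ec'

/-- A path followed by its reverse (up to casting) is homotopic to a constant path. -/
theorem trans_rev_homotopic {a b a' : X} (α : Path a b) (β : Path b a') (δ : Path a a')
    (hβ : ∀ u, β u = α (σ u)) (hδ : ∀ u, δ u = a) : (α.trans β).Homotopic δ := by
  have : a' = a := by rw [← δ.target, hδ]
  subst this
  have e1 : β = α.symm := by ext u; simp [hβ]
  have e2 : δ = Path.refl _ := by ext u; simp [hδ]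
  rw [e1, e2]
  exact ⟨(Path.Homotopy.reflTransSymm α).symm⟩

variable {Y : Type*} [NormedAddCommGroup Y] [NormedSpace ℝ Y]

/-- straight segment -/
noncomputable def seg (a b : Y) : Path a b where
  toFun u := AffineMap.lineMap a b (u : ℝ)
  continuous_toFun := by
    simp only [AffineMap.lineMap_apply_module]
    fun_prop
  source' := by simp
  target' := by simp

theorem seg_apply (a b : Y) (u : I) : seg a b u = AffineMap.lineMap a b (u : ℝ) := rfl

/-- The relation: the path joining `y` to `y'` maps to a null-homotopic loop. -/
def NullRel (p : C(Y, X)) (y y' : Y) : Prop :=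
  ∃ (s : Path y y') (δ : Path (p y) (p y')), (∀ u, δ u = p y) ∧
    (s.map p.continuous).Homotopic δ

theorem NullRel.eq {p : C(Y, X)} {y y' : Y} (h : NullRel p y y') : p y = p y' := by
  obtain ⟨s, δ, h, _⟩ := h
  rw [← h 1, δ.target]

theorem NullRel.refl (p : C(Y, X)) (y : Y) : NullRel p y y :=
  ⟨Path.refl y, Path.refl _, fun _ => rfl, Path.Homotopic.refl _⟩

theorem NullRel.symm {p : C(Y, X)} {y y' : Y} (h : NullRel p y y') : NullRel p y' y := by
  have e := h.eq
  obtain ⟨s, δ, h, hh⟩ := h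
  refine ⟨s.symm, δ.symm, fun u => ?_, ?_⟩
  · exact (h _).trans e
  · rw [← Path.map_symm]; exact hh.symm₂

theorem NullRel.trans {p : C(Y, X)} {y y' y'' : Y} (h : NullRel p y y')
    (h' : NullRel p y' y'') : NullRel p y y'' := by
  have e := h.eq
  obtain ⟨s, δ, h, hh⟩ := h
  obtain ⟨s', δ', h', hh'⟩ := h'
  refine ⟨s.trans s', δ.trans δ', fun u => ?_, ?_⟩
  · rw [Path.trans_apply]
    split_ifs
    · exact h _
    · rw [h', e]
  · rw [Path.map_trans]; exact hh.hcomp hh'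

theorem NullRel.of_fix {p : C(Y, X)} (g : Y → Y) (hg : Continuous g) (hpg : ∀ y, p (g y) = p y)
    (c : Y) (hc : g c = c) (y : Y) : NullRel p y (g y) := by
  let s1 : Path c (g y) := ((seg c y).map hg).cast hc.symm rfl
  refine ⟨(seg y c).trans s1, (Path.refl (p y)).cast rfl (hpg y), fun _ => rfl, ?_⟩
  rw [Path.map_trans]
  refine trans_rev_homotopic _ _ _ (fun u => ?_) (fun _ => rfl)
  simp only [s1, Path.map_coe, Path.cast_coe, Function.comp, hpg, seg_apply]
  rw [unitInterval.coe_symm_eq, AffineMap.lineMap_apply_one_sub]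

/-- lifting up to homotopy -/
def Lifts (p : C(Y, X)) {x x' : X} (γ : Path x x') : Prop :=
  ∀ y (h : p y = x), ∃ (y' : Y) (h' : p y' = x') (s : Path y y'),
    γ.Homotopic ((s.map p.continuous).cast h.symm h'.symm)

theorem Lifts.trans {p : C(Y, X)} {x x' x'' : X} {γ : Path x x'} {γ' : Path x' x''}
    (h : Lifts p γ) (h' : Lifts p γ') : Lifts p (γ.trans γ') := by
  intro y hy
  obtain ⟨y', hy', s, hs⟩ := h y hy
  obtain ⟨y'', hy'', s', hs'⟩ := h' y' hy'
  refine ⟨y'', hy'', s.trans s', ?_⟩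
  subst hy hy' hy''
  rw [Path.map_trans]
  exact hs.hcomp hs'

theorem Lifts.congr {p : C(Y, X)} {x x' : X} {γ γ' : Path x x'}
    (h : Lifts p γ) (h' : γ'.Homotopic γ) : Lifts p γ' := by
  intro y hy
  obtain ⟨y', hy', s, hs⟩ := h y hy
  exact ⟨y', hy', s, h'.trans hs⟩

theorem Lifts.refl (p : C(Y, X)) (x : X) : Lifts p (Path.refl x) := by
  intro y hy
  refine ⟨y, hy, Path.refl y, ?_⟩
  subst hy
  exact Path.Homotopic.refl _

theorem local_lift (p : C(Y, X)) (hop : IsOpenMap p)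
    (hg : ∀ y y', p y = p y' → ∃ g : Y → Y, Continuous g ∧ (∀ z, p (g z) = p z) ∧ g y = y')
    (y₀ : Y) (B : Set Y) (hB : IsOpen B)
    (hc : ∀ b ∈ B, ∀ b' ∈ B, p b = p b' → ∀ s : I,
      p (AffineMap.lineMap b y₀ (s : ℝ)) = p (AffineMap.lineMap b' y₀ (s : ℝ)))
    {x x' : X} (γ : Path x x') (hγ : ∀ u, γ u ∈ p '' B) : Lifts p γ := by
  classical
  intro y hy
  choose sec hsecB hsec using (fun q : (p '' B : Set X) => q.2)
  let r : B → (p '' B : Set X) := fun b => ⟨p b, b, b.2, rfl⟩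
  have hr : IsOpenQuotientMap r :=
    ⟨by rintro ⟨_, b, hb, rfl⟩; exact ⟨⟨b, hb⟩, rfl⟩,
     by have := p.continuous; fun_prop,
     (hop.comp hB.isOpenMap_subtype_val).subtype_mk _⟩
  have hr' : IsOpenQuotientMap (Prod.map r (id : I → I)) := hr.prodMap IsOpenQuotientMap.id
  let H : (p '' B : Set X) × I → X := fun q => p (AffineMap.lineMap (sec q.1) y₀ (q.2 : ℝ))
  have key : ∀ (b : Y) (hb : b ∈ B) (q : (p '' B : Set X)), p b = q → ∀ v : I,
      H (q, v) = p (AffineMap.lineMap b y₀ (v : ℝ)) := by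
    intro b hb q hq v
    exact hc _ (hsecB _) _ hb (by rw [hsec, hq]) v
  have hH : Continuous H := by
    rw [hr'.isQuotientMap.continuous_iff]
    have : H ∘ Prod.map r id = fun q : B × I => p (AffineMap.lineMap (q.1 : Y) y₀ (q.2 : ℝ)) := by
      funext q
      exact key _ q.1.2 _ rfl _
    rw [this]
    refine p.continuous.comp ?_
    simp only [AffineMap.lineMap_apply_module]
    fun_prop
  let S : C(I × I, X) := ⟨fun q => H (⟨γ q.1, hγ _⟩, q.2), by fun_prop⟩
  obtain ⟨b, hb, hbx⟩ := hγ 0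
  obtain ⟨b', hb', hbx'⟩ := hγ 1
  obtain ⟨g, gc, gp, gy⟩ := hg b y (by rw [hbx, hy]; simp)
  refine ⟨g b', by rw [gp, hbx']; simp, (((seg b y₀).trans (seg b' y₀).symm).map gc).cast gy.symm rfl, ?_⟩
  have e0 : x = p b := by rw [hbx]; simp
  have e1 : x' = p b' := by rw [hbx']; simp
  subst e0 e1
  have := square_homotopic S γ ((seg b y₀).map p.continuous) ((seg b' y₀).map p.continuous)
    (fun u => ?_) (fun v => ?_) (fun v => ?_) (fun u => ?_)
  · convert this using 1
    rw [Path.map_symm, ← Path.map_trans]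
    ext u
    exact gp _
  · obtain ⟨c, hcB, hcu⟩ := hγ u
    change H _ = _
    rw [key c hcB _ hcu]
    simpa using hcu
  · change H _ = _
    rw [key b hb _ hbx]; rfl
  · change H _ = _
    rw [key b' hb' _ hbx']; rfl
  · change p _ = _
    simp

theorem lifts_of_local (p : C(Y, X)) (U : X → Set X) (hU : ∀ x, IsOpen (U x))
    (hx : ∀ x, x ∈ U x)
    (hl : ∀ x, ∀ {a b : X} (γ : Path a b), (∀ u, γ u ∈ U x) → Lifts p γ)
    {a b : X} (γ : Path a b) : Lifts p γ := by
  obtain ⟨t, t0, tm, ⟨n, hn⟩, ht⟩ := exists_monotone_Icc_subset_open_cover_unitInterval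
    (c := fun x => γ ⁻¹' U x) (fun x => (hU x).preimage γ.continuous)
    (fun u _ => Set.mem_iUnion.2 ⟨γ u, hx _⟩)
  have main : ∀ k, Lifts p (γ.subpath (t 0) (t k)) := by
    intro k
    induction k with
    | zero => rw [Path.subpath_self]; exact Lifts.refl _ _
    | succ k ih =>
      refine Lifts.congr (ih.trans ?_) ⟨(Path.Homotopy.subpathTransSubpath γ _ (t k) _).symm⟩
      obtain ⟨x, hk⟩ := ht k
      refine hl x _ (fun u => ?_)
      have : γ.subpath (t k) (t (k+1)) u ∈ Set.range (γ.subpath (t k) (t (k+1))) := ⟨u, rfl⟩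
      rw [Path.range_subpath_of_le _ _ _ (tm (Nat.le_succ k))] at this
      obtain ⟨v, hv, e⟩ := this
      rw [← e]
      exact hk hv
  have := main n
  rw [t0, hn n le_rfl, Path.subpath_zero_one] at this
  have e0 := γ.source
  have e1 := γ.target
  intro y hy
  obtain ⟨y', hy', s, hs⟩ := this y (hy.trans e0.symm)
  refine ⟨y', hy'.trans e1, s, ?_⟩
  exact hs.pathCast e0.symm e1.symm

theorem simplyConnected_of_quotient (p : C(Y, X)) (hop : IsOpenMap p)
    (hs : Function.Surjective p)
    (hg : ∀ y y', p y = p y' → ∃ g : Y → Y, Continuous g ∧ (∀ z, p (g z) = p z) ∧ g y = y')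
    (hc : ∀ y₀ : Y, ∃ ε > 0, ∀ b ∈ Metric.ball y₀ ε, ∀ b' ∈ Metric.ball y₀ ε, p b = p b' →
      ∀ s : I, p (AffineMap.lineMap b y₀ (s : ℝ)) = p (AffineMap.lineMap b' y₀ (s : ℝ)))
    (hN : ∀ y y', p y = p y' → NullRel p y y') : SimplyConnectedSpace X := by
  rw [simply_connected_iff_loops_nullhomotopic]
  refine ⟨hs.pathConnectedSpace p.continuous, fun x γ => ?_⟩
  choose ε εpos hε using hc
  choose l hl using hs
  have hL : Lifts p γ := by
    refine lifts_of_local p (fun x => p '' Metric.ball (l x) (ε (l x)))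
      (fun x => hop _ Metric.isOpen_ball)
      (fun x => ⟨l x, Metric.mem_ball_self (εpos _), hl x⟩) (fun x a b γ hγ => ?_) γ
    exact local_lift p hop hg (l x) _ Metric.isOpen_ball (hε (l x)) γ hγ
  obtain ⟨y', h', s, hs⟩ := hL (l x) (hl x)
  obtain ⟨s', δ, hδ, hh⟩ := hN (l x) y' (by rw [hl, h'])
  have : SimplyConnectedSpace Y := SimplyConnectedSpace.ofContractible Y
  have h2 := ((SimplyConnectedSpace.paths_homotopic s s').map p).trans hh
  refine hs.trans ((h2.pathCast (hl x).symm h'.symm).trans ?_)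
  have : δ.cast (hl x).symm h'.symm = Path.refl x := by
    ext u; simp [hδ, hl]
  rw [this]

end Abstract
end X134

namespace X134

section Concrete

abbrev V : Type := ℂ × ℂ × ℂ

abbrev Y : Type := ℝ × V

/-- The linear map `z ↦ (iz₁, iz₂ − iz₁, −z₃)`. -/
noncomputable def Φ : V ≃ₗ[ℝ] V where
  toFun z := (Complex.I * z.1, Complex.I * z.2.1 - Complex.I * z.1, - z.2.2)
  map_add' x y := by ext1 <;> [skip; ext1] <;> simp <;> ring
  map_smul' c x := by
    ext1 <;> [skip; ext1] <;> simp <;> ring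
  invFun z := (-Complex.I * z.1, -Complex.I * z.2.1 - Complex.I * z.1, - z.2.2)
  left_inv z := by
    have := Complex.I_mul_I
    ext1 <;> [skip; ext1] <;> simp <;> grind
  right_inv z := by
    have := Complex.I_mul_I
    ext1 <;> [skip; ext1] <;> simp <;> grind

/-- The linear involution `z ↦ (−z̄₁, z̄₂ + z̄₁, −z̄₃)`. -/
noncomputable def H : V ≃ₗ[ℝ] V where
  toFun z := (-(star z.1), star z.2.1 + star z.1, -(star z.2.2))
  map_add' x y := by ext1 <;> [skip; ext1] <;> simp <;> ring
  map_smul' c x := by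
    ext1 <;> [skip; ext1] <;> simp <;> ring
  invFun z := (-(star z.1), star z.2.1 + star z.1, -(star z.2.2))
  left_inv z := by
    ext1 <;> [skip; ext1] <;> simp
  right_inv z := by
    ext1 <;> [skip; ext1] <;> simp

theorem Φ_apply (z : V) :
    Φ z = (Complex.I * z.1, Complex.I * z.2.1 - Complex.I * z.1, - z.2.2) := rfl

theorem Φ_inv_apply (z : V) :
    Φ⁻¹ z = (-Complex.I * z.1, -Complex.I * z.2.1 - Complex.I * z.1, - z.2.2) := rfl

theorem H_apply (z : V) : H z = (-(star z.1), star z.2.1 + star z.1, -(star z.2.2)) := rfl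

theorem H_H (z : V) : H (H z) = z := H.left_inv z

theorem H_mul_self : H * H = 1 := by
  ext1 z; exact H_H z

theorem H_Φ : H * Φ = Φ⁻¹ * H := by
  ext1 z
  change H (Φ z) = Φ⁻¹ (H z)
  rw [H_apply, Φ_inv_apply, H_apply, Φ_apply]
  ext1 <;> [skip; ext1] <;> simp <;> ring

theorem H_Φ_zpow (n : ℤ) : H * Φ ^ n = Φ ^ (-n) * H := by
  have h : H * Φ * H⁻¹ = Φ⁻¹ := by rw [H_Φ]; group
  have h2 : H * Φ ^ n * H⁻¹ = Φ ^ (-n) := by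
    rw [← conj_zpow, h, inv_zpow, zpow_neg]
  rw [← h2]; group

theorem H_Φ_zpow_apply (n : ℤ) (z : V) : H ((Φ ^ n) z) = (Φ ^ (-n)) (H z) :=
  congrArg (fun g : V ≃ₗ[ℝ] V => g z) (H_Φ_zpow n)

theorem Φ_zpow_add_apply (m n : ℤ) (z : V) : (Φ ^ (m + n)) z = (Φ ^ m) ((Φ ^ n) z) := by
  rw [zpow_add]; rfl

/-- The lattice. -/
noncomputable def Lat : AddSubgroup V := Γ₃.prod (Γ₂.prod Γ₂)

theorem mem_Γ₂ {z : ℂ} : z ∈ Γ₂ ↔ ∃ a b : ℤ, z = a + b * Complex.I := by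
  rw [Γ₂, AddSubgroup.mem_closure_pair]
  simp [eq_comm]

theorem mem_Γ₃ {z : ℂ} : z ∈ Γ₃ ↔ ∃ a b : ℤ, z = a * (1 + Complex.I) + b * (1 - Complex.I) := by
  rw [Γ₃, AddSubgroup.mem_closure_pair]
  simp only [zsmul_eq_mul, eq_comm]

theorem Γ₃_le : Γ₃ ≤ Γ₂ := by
  intro z hz
  obtain ⟨a, b, rfl⟩ := mem_Γ₃.1 hz
  exact mem_Γ₂.2 ⟨a + b, a - b, by push_cast; ring⟩

theorem I_mul_Γ₂ {z : ℂ} (h : z ∈ Γ₂) : Complex.I * z ∈ Γ₂ := by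
  obtain ⟨a, b, rfl⟩ := mem_Γ₂.1 h
  exact mem_Γ₂.2 ⟨-b, a, by push_cast; linear_combination (b:ℂ) * Complex.I_mul_I⟩

theorem I_mul_Γ₃ {z : ℂ} (h : z ∈ Γ₃) : Complex.I * z ∈ Γ₃ := by
  obtain ⟨a, b, rfl⟩ := mem_Γ₃.1 h
  exact mem_Γ₃.2 ⟨b, -a, by push_cast; linear_combination ((a:ℂ) - b) * Complex.I_mul_I⟩

theorem star_Γ₂ {z : ℂ} (h : z ∈ Γ₂) : star z ∈ Γ₂ := by
  obtain ⟨a, b, rfl⟩ := mem_Γ₂.1 h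
  exact mem_Γ₂.2 ⟨a, -b, by simp⟩

theorem star_Γ₃ {z : ℂ} (h : z ∈ Γ₃) : star z ∈ Γ₃ := by
  obtain ⟨a, b, rfl⟩ := mem_Γ₃.1 h
  exact mem_Γ₃.2 ⟨b, a, by simp; ring⟩

theorem mem_Lat {z : V} : z ∈ Lat ↔ z.1 ∈ Γ₃ ∧ z.2.1 ∈ Γ₂ ∧ z.2.2 ∈ Γ₂ := by
  simp [Lat, AddSubgroup.mem_prod]

theorem Φ_mem {z : V} (h : z ∈ Lat) : Φ z ∈ Lat := by
  obtain ⟨h1, h2, h3⟩ := mem_Lat.1 h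
  exact mem_Lat.2 ⟨I_mul_Γ₃ h1, sub_mem (I_mul_Γ₂ h2) (Γ₃_le (I_mul_Γ₃ h1)), neg_mem h3⟩

theorem Φ_inv_mem {z : V} (h : z ∈ Lat) : Φ⁻¹ z ∈ Lat := by
  obtain ⟨h1, h2, h3⟩ := mem_Lat.1 h
  rw [Φ_inv_apply]
  refine mem_Lat.2 ⟨?_, sub_mem ?_ (Γ₃_le (I_mul_Γ₃ h1)), neg_mem h3⟩
  · simpa using neg_mem (I_mul_Γ₃ h1)
  · simpa using neg_mem (I_mul_Γ₂ h2)

theorem H_mem {z : V} (h : z ∈ Lat) : H z ∈ Lat := by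
  obtain ⟨h1, h2, h3⟩ := mem_Lat.1 h
  exact mem_Lat.2 ⟨neg_mem (star_Γ₃ h1), add_mem (star_Γ₂ h2) (Γ₃_le (star_Γ₃ h1)),
    neg_mem (star_Γ₂ h3)⟩

theorem Φ_zpow_mem (n : ℤ) {z : V} (h : z ∈ Lat) : (Φ ^ n) z ∈ Lat := by
  induction n with
  | zero => simpa using h
  | succ n ih => rw [add_comm, Φ_zpow_add_apply]; simpa using Φ_mem ih
  | pred n ih => rw [sub_eq_add_neg, add_comm, Φ_zpow_add_apply, zpow_neg_one]; exact Φ_inv_mem ih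

theorem Γ₂_small {z : ℂ} (h : z ∈ Γ₂) (hz : ‖z‖ < 1) : z = 0 := by
  obtain ⟨a, b, rfl⟩ := mem_Γ₂.1 h
  have h1 := (Complex.abs_re_le_norm _).trans_lt hz
  have h2 := (Complex.abs_im_le_norm _).trans_lt hz
  simp at h1 h2
  norm_cast at h1 h2
  rw [Int.abs_lt_one_iff] at h1 h2
  simp [h1, h2]

theorem Lat_small {z : V} (h : z ∈ Lat) (hz : ‖z‖ < 1) : z = 0 := by
  obtain ⟨h1, h2, h3⟩ := mem_Lat.1 h
  have n1 := (norm_fst_le z).trans_lt hz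
  have n2 := (norm_snd_le z).trans_lt hz
  have n3 := (norm_fst_le z.2).trans_lt n2
  have n4 := (norm_snd_le z.2).trans_lt n2
  ext1
  · exact Γ₂_small (Γ₃_le h1) n1
  · ext1
    · exact Γ₂_small h2 n3
    · exact Γ₂_small h3 n4

/-- explicit orbit relation -/
def D (y y' : Y) : Prop :=
  ∃ n : ℤ, ∃ l ∈ Lat, y' = (y.1 + n, (Φ ^ n) y.2 + l) ∨ y' = (n + 1 - y.1, (Φ ^ n) (H y.2) + l)

theorem D_refl (y : Y) : D y y := ⟨0, 0, zero_mem _, Or.inl (by simp)⟩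

theorem D_trans {y y' : Y} {l : V} (hl : l ∈ Lat) (h : D (y.1, y.2 + l) y') : D y y' := by
  obtain ⟨n, m, hm, h | h⟩ := h
  · exact ⟨n, (Φ ^ n) l + m, add_mem (Φ_zpow_mem n hl) hm, Or.inl (by
      rw [h]; simp [add_assoc])⟩
  · exact ⟨n, (Φ ^ n) (H l) + m, add_mem (Φ_zpow_mem n (H_mem hl)) hm, Or.inr (by
      rw [h]; simp [add_assoc])⟩

theorem D_f (k : ℤ) {y y' : Y} (h : D (y.1 + k, (Φ ^ k) y.2) y') : D y y' := by
  obtain ⟨n, m, hm, h | h⟩ := h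
  · exact ⟨n + k, m, hm, Or.inl (by
      rw [h, Φ_zpow_add_apply]; ext1
      · push_cast; ring
      · rfl)⟩
  · exact ⟨n - k, m, hm, Or.inr (by
      have e : (Φ ^ (n - k)) (H y.2) = (Φ ^ n) (H ((Φ ^ k) y.2)) := by
        rw [sub_eq_add_neg, Φ_zpow_add_apply, ← H_Φ_zpow_apply]
      rw [h, e]; ext1
      · push_cast; ring
      · rfl)⟩

theorem D_k {y y' : Y} (h : D (1 - y.1, H y.2) y') : D y y' := by
  obtain ⟨n, m, hm, h | h⟩ := h
  · exact ⟨n, m, hm, Or.inr (by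
      rw [h]; ext1
      · simp only; ring
      · rfl)⟩
  · exact ⟨n, m, hm, Or.inl (by
      rw [h]; ext1
      · simp only; ring
      · simp only [H_H])⟩

theorem line_coord (b y₀ : Y) (s : ℝ) : AffineMap.lineMap b y₀ s =
    ((1 - s) * b.1 + s * y₀.1, (1 - s) • b.2 + s • y₀.2) := by
  rw [AffineMap.lineMap_apply_module]; rfl

/-- local structure of the orbit relation -/
theorem D_local (y₀ : Y) : ∃ ε > 0, ∀ b ∈ Metric.ball y₀ ε, ∀ b' ∈ Metric.ball y₀ ε, D b b' →
    ∀ s : ℝ, D (AffineMap.lineMap b y₀ s) (AffineMap.lineMap b' y₀ s) := by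
  obtain ⟨t₀, z₀⟩ := y₀
  set n₀ : ℤ := round (2 * t₀ - 1) with hn₀
  obtain ⟨δ₁, hδ₁, h1⟩ : ∃ δ > 0, |(n₀ + 1 - 2 * t₀ : ℝ)| < δ → (n₀ + 1 - 2 * t₀ : ℝ) = 0 := by
    by_cases h : (n₀ + 1 - 2 * t₀ : ℝ) = 0
    · exact ⟨1, one_pos, fun _ => h⟩
    · exact ⟨_, abs_pos.2 h, fun h' => absurd h' (lt_irrefl _)⟩
  let A : V →L[ℝ] V := LinearMap.toContinuousLinearMap
    ((Φ ^ n₀ * H : V ≃ₗ[ℝ] V) : V →ₗ[ℝ] V)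
  have hA : ∀ z, A z = (Φ ^ n₀) (H z) := fun z => rfl
  obtain ⟨δ₂, hδ₂, h2⟩ : ∃ δ > 0, ∀ l ∈ Lat, ‖A z₀ + l - z₀‖ < δ → A z₀ + l - z₀ = 0 := by
    by_cases h : ∃ l ∈ Lat, ‖A z₀ + l - z₀‖ < 1/2 ∧ A z₀ + l - z₀ ≠ 0
    · obtain ⟨l, hl, hl1, hl2⟩ := h
      refine ⟨‖A z₀ + l - z₀‖, norm_pos_iff.2 hl2, fun m hm hm' => ?_⟩
      have : l - m = 0 := by
        refine Lat_small (sub_mem hl hm) ?_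
        have e : l - m = (A z₀ + l - z₀) - (A z₀ + m - z₀) := by abel
        rw [e]
        refine (norm_sub_le _ _).trans_lt ?_
        linarith
      rw [sub_eq_zero] at this
      rw [this] at hm'
      exact absurd hm' (lt_irrefl _)
    · push Not at h
      exact ⟨1/2, by norm_num, h⟩
  have hC : 0 < 1 + ‖A‖ := by positivity
  refine ⟨min (1/4) (min (δ₁ / 2) (δ₂ / (1 + ‖A‖))), by positivity, ?_⟩
  rintro ⟨t, z⟩ hb ⟨t', z'⟩ hb' ⟨n, l, hl, h | h⟩ s
  · obtain ⟨ht, hz⟩ := Prod.mk.inj h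
    rw [Metric.mem_ball, Prod.dist_eq, max_lt_iff] at hb hb'
    simp only [lt_min_iff, dist_eq_norm] at hb hb' ht hz
    have e0 : n = 0 := by
      rw [← Int.abs_lt_one_iff]
      have : |(n : ℝ)| < 1 := by
        have := hb.1.1
        have := hb'.1.1
        rw [Real.norm_eq_abs, abs_lt] at *
        constructor <;> linarith
      exact_mod_cast this
    subst e0
    have e1 : l = 0 := by
      refine Lat_small hl ?_
      have : l = (z' - z₀) - (z - z₀) := by rw [hz]; simp
      rw [this]
      refine (norm_sub_le _ _).trans_lt ?_
      linarith [hb.2.1, hb'.2.1]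
    subst e1
    simp at ht hz
    subst ht hz
    exact D_refl _
  · obtain ⟨ht, hz⟩ := Prod.mk.inj h
    rw [Metric.mem_ball, Prod.dist_eq, max_lt_iff] at hb hb'
    simp only [lt_min_iff, dist_eq_norm] at hb hb' ht hz
    have b1 := hb.1.1
    have b2 := hb'.1.1
    have b3 := hb.1.2.1
    have b4 := hb'.1.2.1
    rw [Real.norm_eq_abs, abs_lt] at b1 b2 b3 b4
    have e0 : n = n₀ := by
      rw [← sub_eq_zero, ← Int.abs_lt_one_iff]
      have : |((n : ℝ) - n₀)| < 1 := by
        have h := abs_sub_round (2 * t₀ - 1)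
        rw [← hn₀, abs_le] at h
        rw [abs_lt]
        constructor <;> linarith
      exact_mod_cast this
    subst e0
    have e1 := h1 (by rw [abs_lt]; constructor <;> linarith)
    have e2 := h2 l hl (by
      have c1 := hb.2.2.2
      have c2 := hb'.2.2.2
      have e : A z₀ + l - z₀ = (z' - z₀) - A (z - z₀) := by
        rw [hz, map_sub, hA z]; abel
      rw [e]
      refine (norm_sub_le _ _).trans_lt ?_
      have c3 := A.le_opNorm (z - z₀)
      have c4 : ‖A‖ * ‖z - z₀‖ ≤ ‖A‖ * (δ₂ / (1 + ‖A‖)) := by gcongr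
      have c5 : δ₂ = δ₂ / (1 + ‖A‖) + ‖A‖ * (δ₂ / (1 + ‖A‖)) := by field_simp
      linarith)
    refine ⟨n₀, l, hl, Or.inr ?_⟩
    rw [line_coord, line_coord]
    simp only
    rw [← hA, ht, hz, ← hA]
    ext1
    · simp only
      linear_combination (-s) * e1
    · simp only [map_add, map_smul]
      have : z₀ = A z₀ + l := (sub_eq_zero.1 e2).symm
      nth_rewrite 1 [this]
      module

/-- `K n l` : the glide map `(t,z) ↦ (n + 1 - t, Φ^n H z + l)`. -/
noncomputable def K (n : ℤ) (l : V) (y : Y) : Y := (n + 1 - y.1, (Φ ^ n) (H y.2) + l)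

theorem K_cont (n : ℤ) (l : V) : Continuous (K n l) := by
  have h1 : Continuous (Φ ^ n) := LinearMap.continuous_of_finiteDimensional
    ((Φ ^ n : V ≃ₗ[ℝ] V) : V →ₗ[ℝ] V)
  have h2 : Continuous H := LinearMap.continuous_of_finiteDimensional (H : V →ₗ[ℝ] V)
  unfold K
  fun_prop

theorem K_fix (n : ℤ) (l : V) (h : (Φ ^ n) (H l) = - l) :
    K n l (((n : ℝ) + 1) / 2, (1 / 2 : ℝ) • l) = (((n : ℝ) + 1) / 2, (1 / 2 : ℝ) • l) := by
  unfold K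
  ext1
  · simp only; ring
  · simp only [map_smul, h]
    module

section Null

variable {X : Type*} [TopologicalSpace X] (p : C(Y, X))

/-- generating: all orbit-related points are null-related -/
theorem null_all
    (hp : ∀ y y', D y y' → p y = p y') :
    (∀ (l : V), l ∈ Lat → ∀ y : Y, NullRel p y (y.1, y.2 + l)) ∧
    (∀ y : Y, NullRel p y (y.1 + 1, Φ y.2)) ∧
    (∀ y : Y, NullRel p y (1 - y.1, H y.2)) := by
  have hK : ∀ (n : ℤ) (l : V), l ∈ Lat → (Φ ^ n) (H l) = - l → ∀ y, NullRel p y (K n l y) :=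
    fun n l hl h y => NullRel.of_fix _ (K_cont n l)
      (fun y => (hp _ _ ⟨n, l, hl, Or.inr rfl⟩).symm) _ (K_fix n l h) y
  have hk : ∀ y : Y, NullRel p y (1 - y.1, H y.2) := by
    intro y
    have := hK 0 0 (zero_mem _) (by simp) y
    simpa [K] using this
  have hKK : ∀ (n : ℤ) (l : V), l ∈ Lat → (Φ ^ n) (H l) = - l → ∀ y : Y,
      NullRel p y (y.1, y.2 + l) := by
    intro n l hl h y
    have a1 := hK n 0 (zero_mem _) (by simp) y
    have a2 := hK n l hl h (K n 0 y)
    have := a1.trans a2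
    have e : K n l (K n 0 y) = (y.1, y.2 + l) := by
      unfold K
      ext1
      · simp only; ring
      · simp only [add_zero, H_Φ_zpow_apply, H_H]
        rw [← Φ_zpow_add_apply]; simp
    rwa [e] at this
  have hf : ∀ y : Y, NullRel p y (y.1 + 1, Φ y.2) := by
    intro y
    have a1 := hK (-1) 0 (zero_mem _) (by simp) y
    have := a1.trans (hk _)
    have e : ((1 - (K (-1) 0 y).1, H (K (-1) 0 y).2) : Y) = (y.1 + 1, Φ y.2) := by
      unfold K
      ext1
      · push_cast; ring
      · simp only [add_zero, H_Φ_zpow_apply, H_H]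
        simp
    rwa [e] at this
  refine ⟨?_, hf, hk⟩
  let L : AddSubgroup V :=
    { carrier := {l | ∀ y : Y, NullRel p y (y.1, y.2 + l)}
      zero_mem' := by
        intro y
        simpa using NullRel.refl p y
      add_mem' := by
        intro a b ha hb y
        have := (ha y).trans (hb _)
        simpa [add_assoc] using this
      neg_mem' := by
        intro a ha y
        have := ha (y.1, y.2 + -a)
        simpa using this.symm }
  have hI := Complex.I_mul_I
  have g2I : Complex.I ∈ Γ₂ := mem_Γ₂.2 ⟨0, 1, by simp⟩
  have g21 : (1 : ℂ) ∈ Γ₂ := mem_Γ₂.2 ⟨1, 0, by simp⟩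
  have m1 : ((2, -1, 0) : V) ∈ L := hKK 0 _
    (mem_Lat.2 ⟨mem_Γ₃.2 ⟨1, 1, by push_cast; ring⟩, neg_mem g21, zero_mem _⟩)
    (by simp [H_apply]; norm_num)
  have m2 : ((0, Complex.I, 0) : V) ∈ L := hKK 0 _
    (mem_Lat.2 ⟨zero_mem _, g2I, zero_mem _⟩) (by simp [H_apply])
  have m3 : ((0, 0, 1) : V) ∈ L := hKK 0 _
    (mem_Lat.2 ⟨zero_mem _, zero_mem _, g21⟩) (by simp [H_apply])
  have m4 : ((1 - Complex.I, 0, 0) : V) ∈ L := hKK (-1) _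
    (mem_Lat.2 ⟨mem_Γ₃.2 ⟨0, 1, by simp⟩, zero_mem _, zero_mem _⟩)
    (by rw [zpow_neg_one, H_apply, Φ_inv_apply]
        ext1 <;> [skip; ext1] <;> simp <;> grind)
  have m5 : ((0, 1 + Complex.I, 0) : V) ∈ L := hKK (-1) _
    (mem_Lat.2 ⟨zero_mem _, add_mem g21 g2I, zero_mem _⟩)
    (by rw [zpow_neg_one, H_apply, Φ_inv_apply]
        ext1 <;> [skip; ext1] <;> simp <;> grind)
  have m6 : ((0, 0, Complex.I) : V) ∈ L := hKK (-1) _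
    (mem_Lat.2 ⟨zero_mem _, zero_mem _, g2I⟩)
    (by rw [zpow_neg_one, H_apply, Φ_inv_apply]
        ext1 <;> [skip; ext1] <;> simp)
  have m7 : ((0, 1, 0) : V) ∈ L := by
    have := sub_mem m5 m2
    simpa using this
  have m8 : ((1 + Complex.I, 0, 0) : V) ∈ L := by
    have := sub_mem (add_mem m1 m7) m4
    have e : ((2, -1, 0) + (0, 1, 0) - (1 - Complex.I, 0, 0) : V) = (1 + Complex.I, 0, 0) := by
      ext1 <;> [skip; ext1] <;> simp <;> ring
    rwa [e] at this
  rintro ⟨l1, l2, l3⟩ hl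
  obtain ⟨h1, h2, h3⟩ := mem_Lat.1 hl
  obtain ⟨a1, b1, e1⟩ := mem_Γ₃.1 h1
  obtain ⟨a2, b2, e2⟩ := mem_Γ₂.1 h2
  obtain ⟨a3, b3, e3⟩ := mem_Γ₂.1 h3
  simp only at e1 e2 e3
  have := add_mem (add_mem (add_mem (zsmul_mem m8 a1) (zsmul_mem m4 b1))
    (add_mem (zsmul_mem m7 a2) (zsmul_mem m2 b2))) (add_mem (zsmul_mem m3 a3) (zsmul_mem m6 b3))
  have e : (l1, l2, l3) = (a1 • ((1 + Complex.I, 0, 0) : V) + b1 • ((1 - Complex.I, 0, 0) : V) +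
    (a2 • ((0, 1, 0) : V) + b2 • ((0, Complex.I, 0) : V)) +
    (a3 • ((0, 0, 1) : V) + b3 • ((0, 0, Complex.I) : V))) := by
    ext1 <;> [skip; ext1] <;> simp [e1, e2, e3] <;> ring
  rw [← e] at this
  exact this

end Null

section Final

/-- The covering of the torus times the line. -/
noncomputable def q (y : Y) : ℝ × T₃ := (y.1, (mkA y.2.1, mkB y.2.2.1, mkB y.2.2.2))

theorem q_open : IsOpenQuotientMap q := by
  have hA : IsOpenQuotientMap mkA := QuotientAddGroup.isOpenQuotientMap_mk
  have hB : IsOpenQuotientMap mkB := QuotientAddGroup.isOpenQuotientMap_mk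
  exact IsOpenQuotientMap.id.prodMap (hA.prodMap (hB.prodMap hB))

theorem q_eq {y y' : Y} (h : q y = q y') : y.1 = y'.1 ∧ y'.2 - y.2 ∈ Lat := by
  simp only [q, mkA, mkB, Prod.mk.injEq, QuotientAddGroup.eq] at h
  refine ⟨h.1, mem_Lat.2 ?_⟩
  simpa [sub_eq_add_neg, add_comm] using h.2

theorem q_add (y : Y) {l : V} (hl : l ∈ Lat) : q (y.1, y.2 + l) = q y := by
  obtain ⟨h1, h2, h3⟩ := mem_Lat.1 hl
  simp only [q, mkA, mkB, Prod.mk.injEq, QuotientAddGroup.eq, true_and]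
  refine ⟨?_, ?_, ?_⟩
  · simpa using h1
  · simpa using h2
  · simpa using h3

abbrev XX (F : T₃ → T₃)
    (κ : Quot (mtRel F) → Quot (mtRel F)) : Type := Quot (fun a b => b = κ a)

/-- The total projection. -/
noncomputable def pr (F : T₃ → T₃)
    (κ : Quot (mtRel F) → Quot (mtRel F))
    (y : Y) : XX F κ := Quot.mk _ (Quot.mk (mtRel F) (q y))

theorem pr_quot (F : T₃ → T₃)
    (κ : Quot (mtRel F) → Quot (mtRel F)) : Topology.IsQuotientMap (pr F κ) :=
  (isQuotientMap_quot_mk.comp isQuotientMap_quot_mk).comp q_open.isQuotientMap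

theorem pr_add (F : T₃ → T₃)
    (κ : Quot (mtRel F) → Quot (mtRel F))
    (y : Y) {l : V} (hl : l ∈ Lat) : pr F κ (y.1, y.2 + l) = pr F κ y := by
  unfold pr; rw [q_add y hl]

theorem pr_f (F : T₃ → T₃)
    (hF : ∀ z₁ z₂ z₃ : ℂ,
      F (mkA z₁, mkB z₂, mkB z₃) =
        (mkA (Complex.I * z₁), mkB (Complex.I * z₂ - Complex.I * z₁), mkB (-z₃)))
    (κ : Quot (mtRel F) → Quot (mtRel F))
    (y : Y) : pr F κ (y.1 + 1, Φ y.2) = pr F κ y := by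
  unfold pr
  congr 1
  refine (Quot.sound ?_).symm
  unfold mtRel q
  rw [hF]
  rfl

theorem pr_k (F : T₃ → T₃)
    (κ : Quot (mtRel F) → Quot (mtRel F))
    (hκ : ∀ (t : ℝ) (z₁ z₂ z₃ : ℂ),
      κ (Quot.mk (mtRel F) (t, (mkA z₁, mkB z₂, mkB z₃))) =
        Quot.mk (mtRel F)
          (1 - t, (mkA (-(star z₁)), mkB (star z₂ + star z₁), mkB (-(star z₃)))))
    (y : Y) : pr F κ (1 - y.1, H y.2) = pr F κ y := by
  unfold pr
  refine (Quot.sound ?_).symm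
  unfold q
  rw [hκ]
  rfl

/-- Universal property of the fibres of `pr`. -/
theorem pr_univ (F : T₃ → T₃)
    (hF : ∀ z₁ z₂ z₃ : ℂ,
      F (mkA z₁, mkB z₂, mkB z₃) =
        (mkA (Complex.I * z₁), mkB (Complex.I * z₂ - Complex.I * z₁), mkB (-z₃)))
    (κ : Quot (mtRel F) → Quot (mtRel F))
    (hκ : ∀ (t : ℝ) (z₁ z₂ z₃ : ℂ),
      κ (Quot.mk (mtRel F) (t, (mkA z₁, mkB z₂, mkB z₃))) =
        Quot.mk (mtRel F)
          (1 - t, (mkA (-(star z₁)), mkB (star z₂ + star z₁), mkB (-(star z₃)))))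
    (E : Y → Y → Prop) (hE : Equivalence E)
    (h1 : ∀ l ∈ Lat, ∀ y : Y, E y (y.1, y.2 + l))
    (h2 : ∀ y : Y, E y (y.1 + 1, Φ y.2))
    (h3 : ∀ y : Y, E y (1 - y.1, H y.2)) {y y' : Y} (h : pr F κ y = pr F κ y') : E y y' := by
  let st : Setoid Y := ⟨E, hE⟩
  choose s hs using q_open.surjective
  let g0 : ℝ × T₃ → Quotient st := fun x => Quotient.mk st (s x)
  have hg0 : ∀ y, g0 (q y) = Quotient.mk st y := by
    intro y
    refine Quotient.sound ?_
    obtain ⟨e1, e2⟩ := q_eq (hs (q y))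
    have := h1 _ e2 (s (q y))
    have e : ((s (q y)).1, (s (q y)).2 + (y.2 - (s (q y)).2)) = y := by
      ext1
      · exact e1
      · simp
    rwa [e] at this
  let g1 : Quot (mtRel F) → Quotient st := Quot.lift g0 (by
    intro a b hab
    obtain ⟨y, rfl⟩ := q_open.surjective a
    have : b = q (y.1 + 1, Φ y.2) := by
      rw [hab]; unfold q; rw [hF]; rfl
    rw [this, hg0, hg0]
    exact Quotient.sound (h2 y))
  let g2 : XX F κ → Quotient st := Quot.lift g1 (by
    intro a b hab
    obtain ⟨x, rfl⟩ := Quot.exists_rep a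
    obtain ⟨y, rfl⟩ := q_open.surjective x
    have : b = Quot.mk _ (q (1 - y.1, H y.2)) := by
      rw [hab]; unfold q; rw [hκ]; rfl
    rw [this]
    change g0 _ = g0 _
    rw [hg0, hg0]
    exact Quotient.sound (h3 y))
  have hg2 : ∀ y, g2 (pr F κ y) = Quotient.mk st y := hg0
  have : Quotient.mk st y = Quotient.mk st y' := by rw [← hg2, ← hg2, h]
  exact Quotient.exact this

theorem pr_f_zpow (F : T₃ → T₃)
    (hF : ∀ z₁ z₂ z₃ : ℂ,
      F (mkA z₁, mkB z₂, mkB z₃) =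
        (mkA (Complex.I * z₁), mkB (Complex.I * z₂ - Complex.I * z₁), mkB (-z₃)))
    (κ : Quot (mtRel F) → Quot (mtRel F))
    (n : ℤ) (y : Y) : pr F κ (y.1 + n, (Φ ^ n) y.2) = pr F κ y := by
  induction n with
  | zero => simp
  | succ n ih =>
    rw [← ih, ← pr_f F hF κ (y.1 + ((n : ℤ) : ℝ), (Φ ^ (n : ℤ)) y.2), add_comm (n : ℤ) 1,
      Φ_zpow_add_apply, zpow_one]
    push_cast
    congr 2
    ring
  | pred n ih =>
    rw [← ih, ← pr_f F hF κ (y.1 + ((-(n : ℤ) - 1 : ℤ) : ℝ), (Φ ^ (-(n : ℤ) - 1)) y.2)]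
    have e : Φ ((Φ ^ (-(n : ℤ) - 1)) y.2) = (Φ ^ (-(n : ℤ))) y.2 := by
      have := Φ_zpow_add_apply 1 (-(n : ℤ) - 1) y.2
      rw [zpow_one] at this
      rw [← this]; congr 2; ring
    simp only [e]
    push_cast
    congr 2
    ring

theorem pr_of_D (F : T₃ → T₃)
    (hF : ∀ z₁ z₂ z₃ : ℂ,
      F (mkA z₁, mkB z₂, mkB z₃) =
        (mkA (Complex.I * z₁), mkB (Complex.I * z₂ - Complex.I * z₁), mkB (-z₃)))
    (κ : Quot (mtRel F) → Quot (mtRel F))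
    (hκ : ∀ (t : ℝ) (z₁ z₂ z₃ : ℂ),
      κ (Quot.mk (mtRel F) (t, (mkA z₁, mkB z₂, mkB z₃))) =
        Quot.mk (mtRel F)
          (1 - t, (mkA (-(star z₁)), mkB (star z₂ + star z₁), mkB (-(star z₃)))))
    {y y' : Y} (h : D y y') : pr F κ y = pr F κ y' := by
  obtain ⟨n, l, hl, rfl | rfl⟩ := h
  · rw [pr_add F κ (y.1 + (n : ℝ), (Φ ^ n) y.2) hl, pr_f_zpow F hF]
  · rw [pr_add F κ (n + 1 - y.1, (Φ ^ n) (H y.2)) hl, ← pr_k F κ hκ y,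
      ← pr_f_zpow F hF κ n (1 - y.1, H y.2)]
    congr 2
    simp only
    ring

theorem D_of_pr (F : T₃ → T₃)
    (hF : ∀ z₁ z₂ z₃ : ℂ,
      F (mkA z₁, mkB z₂, mkB z₃) =
        (mkA (Complex.I * z₁), mkB (Complex.I * z₂ - Complex.I * z₁), mkB (-z₃)))
    (κ : Quot (mtRel F) → Quot (mtRel F))
    (hκ : ∀ (t : ℝ) (z₁ z₂ z₃ : ℂ),
      κ (Quot.mk (mtRel F) (t, (mkA z₁, mkB z₂, mkB z₃))) =
        Quot.mk (mtRel F)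
          (1 - t, (mkA (-(star z₁)), mkB (star z₂ + star z₁), mkB (-(star z₃)))))
    {y y' : Y} (h : pr F κ y = pr F κ y') : D y y' := by
  have key : ∀ y'', D y y'' ↔ D y' y'' := by
    refine pr_univ F hF κ hκ (fun a b => ∀ c, D a c ↔ D b c)
      ⟨fun _ _ => Iff.rfl, fun h c => (h c).symm, fun h h' c => (h c).trans (h' c)⟩ ?_ ?_ ?_ h
    · intro l hl y c
      refine ⟨fun hc => D_trans (neg_mem hl) ?_, D_trans hl⟩
      simpa using hc
    · intro y c
      constructor
      · intro hc
        refine D_f (-1) ?_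
        have e : (((y.1 + 1, Φ y.2) : Y).1 + ((-1 : ℤ) : ℝ), (Φ ^ (-1 : ℤ)) ((y.1 + 1, Φ y.2) : Y).2)
            = y := by
          ext1
          · simp
          · rw [zpow_neg_one]; exact Φ.symm_apply_apply _
        rwa [e]
      · intro hc
        refine D_f 1 ?_
        simpa using hc
    · intro y c
      refine ⟨fun hc => D_k ?_, D_k⟩
      simpa [H_H] using hc
  exact (key y').2 (D_refl y')

theorem exists_homeo (F : T₃ → T₃)
    (hF : ∀ z₁ z₂ z₃ : ℂ,
      F (mkA z₁, mkB z₂, mkB z₃) =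
        (mkA (Complex.I * z₁), mkB (Complex.I * z₂ - Complex.I * z₁), mkB (-z₃)))
    (κ : Quot (mtRel F) → Quot (mtRel F))
    (hκ : ∀ (t : ℝ) (z₁ z₂ z₃ : ℂ),
      κ (Quot.mk (mtRel F) (t, (mkA z₁, mkB z₂, mkB z₃))) =
        Quot.mk (mtRel F)
          (1 - t, (mkA (-(star z₁)), mkB (star z₂ + star z₁), mkB (-(star z₃)))))
    {y y' : Y} (h : pr F κ y = pr F κ y') :
    ∃ g : Y ≃ₜ Y, (∀ z, pr F κ (g z) = pr F κ z) ∧ g y = y' := by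
  refine pr_univ F hF κ hκ (fun y y' => ∃ g : Y ≃ₜ Y, (∀ z, pr F κ (g z) = pr F κ z) ∧ g y = y')
    ⟨?_, ?_, ?_⟩ ?_ ?_ ?_ h
  · exact fun y => ⟨Homeomorph.refl _, fun _ => rfl, rfl⟩
  · rintro y y' ⟨g, hg, rfl⟩
    exact ⟨g.symm, fun z => by rw [← hg]; simp, by simp⟩
  · rintro y y' y'' ⟨g, hg, rfl⟩ ⟨g', hg', rfl⟩
    exact ⟨g.trans g', fun z => by simp [hg, hg'], rfl⟩
  · intro l hl y
    exact ⟨(Homeomorph.refl ℝ).prodCongr (Homeomorph.addRight l),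
      fun z => pr_add F κ z hl, rfl⟩
  · intro y
    exact ⟨(Homeomorph.addRight (1 : ℝ)).prodCongr Φ.toContinuousLinearEquiv.toHomeomorph,
      fun z => pr_f F hF κ z, rfl⟩
  · intro y
    exact ⟨(Homeomorph.subLeft (1 : ℝ)).prodCongr H.toContinuousLinearEquiv.toHomeomorph,
      fun z => pr_k F κ hκ z, rfl⟩

theorem pr_open (F : T₃ → T₃)
    (hF : ∀ z₁ z₂ z₃ : ℂ,
      F (mkA z₁, mkB z₂, mkB z₃) =
        (mkA (Complex.I * z₁), mkB (Complex.I * z₂ - Complex.I * z₁), mkB (-z₃)))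
    (κ : Quot (mtRel F) → Quot (mtRel F))
    (hκ : ∀ (t : ℝ) (z₁ z₂ z₃ : ℂ),
      κ (Quot.mk (mtRel F) (t, (mkA z₁, mkB z₂, mkB z₃))) =
        Quot.mk (mtRel F)
          (1 - t, (mkA (-(star z₁)), mkB (star z₂ + star z₁), mkB (-(star z₃))))) : IsOpenMap (pr F κ) := by
  intro U hU
  rw [← (pr_quot F κ).isOpen_preimage]
  have : pr F κ ⁻¹' (pr F κ '' U) =
      ⋃ g : {g : Y ≃ₜ Y // ∀ z, pr F κ (g z) = pr F κ z}, g.1 ⁻¹' U := by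
    ext y
    simp only [Set.mem_preimage, Set.mem_image, Set.mem_iUnion]
    constructor
    · rintro ⟨u, hu, e⟩
      obtain ⟨g, hg, h⟩ := exists_homeo F hF κ hκ e.symm
      exact ⟨⟨g, hg⟩, by simpa [h] using hu⟩
    · rintro ⟨g, hg⟩
      exact ⟨_, hg, g.2 y⟩
  rw [this]
  exact isOpen_iUnion fun g => hU.preimage g.1.continuous

theorem main (F : T₃ → T₃)
    (hF : ∀ z₁ z₂ z₃ : ℂ,
      F (mkA z₁, mkB z₂, mkB z₃) =
        (mkA (Complex.I * z₁), mkB (Complex.I * z₂ - Complex.I * z₁), mkB (-z₃)))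
    (κ : Quot (mtRel F) → Quot (mtRel F))
    (hκ : ∀ (t : ℝ) (z₁ z₂ z₃ : ℂ),
      κ (Quot.mk (mtRel F) (t, (mkA z₁, mkB z₂, mkB z₃))) =
        Quot.mk (mtRel F)
          (1 - t, (mkA (-(star z₁)), mkB (star z₂ + star z₁), mkB (-(star z₃))))) : SimplyConnectedSpace (XX F κ) := by
  let p : C(Y, XX F κ) := ⟨pr F κ, (pr_quot F κ).continuous⟩
  obtain ⟨n1, n2, n3⟩ := null_all p (fun y y' h => pr_of_D F hF κ hκ h)
  refine simplyConnected_of_quotient p (pr_open F hF κ hκ) (pr_quot F κ).surjective ?_ ?_ ?_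
  · intro y y' h
    obtain ⟨g, hg, e⟩ := exists_homeo F hF κ hκ h
    exact ⟨g, g.continuous, hg, e⟩
  · intro y₀
    obtain ⟨ε, h, hε⟩ := D_local y₀
    exact ⟨ε, h, fun b hb b' hb' e s =>
      pr_of_D F hF κ hκ (hε b hb b' hb' (D_of_pr F hF κ hκ e) s)⟩
  · intro y y' h
    exact pr_univ F hF κ hκ (NullRel p)
      ⟨NullRel.refl p, NullRel.symm, NullRel.trans⟩ n1 n2 n3 h

end Final

end Concrete
end X134

/-- Let `F : T → T` be induced by `z ↦ (iz₁, iz₂ − iz₁, −z₃)`, `M` the mapping torus of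
`F`, `κ[t,x] = [1−t, η x]` with `η` induced by `z ↦ (−z̄₁, z̄₂ + z̄₁, −z̄₃)`, and
`X = M/κ`. Then `X` is simply connected. -/
theorem simply_connected_X134 (F : T₃ → T₃)
    (hF : ∀ z₁ z₂ z₃ : ℂ,
      F (mkA z₁, mkB z₂, mkB z₃) =
        (mkA (Complex.I * z₁), mkB (Complex.I * z₂ - Complex.I * z₁), mkB (-z₃)))
    (κ : Quot (mtRel F) → Quot (mtRel F))
    (hκ : ∀ (t : ℝ) (z₁ z₂ z₃ : ℂ),
      κ (Quot.mk (mtRel F) (t, (mkA z₁, mkB z₂, mkB z₃))) =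
        Quot.mk (mtRel F)
          (1 - t, (mkA (-(star z₁)), mkB (star z₂ + star z₁), mkB (-(star z₃))))) :
    SimplyConnectedSpace (Quot (fun a b => b = κ a)) := by
  exact X134.main F hF κ hκ
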